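/- Symmetrization identity (identity (4.12)): Fix ω ∈ ℝ. Let k ≥ 1 and N ≥ 2k, and let ψ be a symmetric Schwartz function on ℝ^N. Then Re ⟨ψ, ∏_{i=1}^k (S²_{2i−1} + S²_{2i}) ψ⟩ = 2^k · Re ⟨ψ, S₁² S₂² ⋯ S_k² ψ⟩, where the products are compositions of the (pairwise commuting) operators indicated. -/

import Mathlib

open MeasureTheory Complex
open scoped BigOperators

noncomputable section

/-- Second partial derivative `∂²_{x_j} ψ` of a function of `N` real variables. -/
def d2 {N : ℕ} (j : Fin N) (ψ : (Fin N → ℝ) → ℂ) : (Fin N → ℝ) → ℂ :=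
  fun x => iteratedDeriv 2 (fun t => ψ (Function.update x j t)) (x j)

/-- The one-particle operator `S_j² ψ = ψ - ½ ∂²_{x_j} ψ + ½ ω² x_j² ψ`. -/
def Ssq {N : ℕ} (ω : ℝ) (j : Fin N) (ψ : (Fin N → ℝ) → ℂ) : (Fin N → ℝ) → ℂ :=
  fun x => ψ x - (1/2 : ℂ) * d2 j ψ x + (1/2 : ℂ) * (ω : ℂ) ^ 2 * ((x j : ℝ) : ℂ) ^ 2 * ψ x

/-- The `N`-body Hamiltonian
`H_N ψ = Σ_j (-½ ∂²_{x_j} ψ + ½ ω² x_j² ψ)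
  + (1/N) Σ_{i<j} N^β V(N^β (x_i - x_j)) ψ`. -/
def HamN (ω β : ℝ) (V : ℝ → ℝ) (N : ℕ) (ψ : (Fin N → ℝ) → ℂ) : (Fin N → ℝ) → ℂ :=
  fun x =>
    (∑ j : Fin N, (-(1/2 : ℂ) * d2 j ψ x + (1/2 : ℂ) * (ω : ℂ) ^ 2 * ((x j : ℝ) : ℂ) ^ 2 * ψ x))
    + ((N : ℂ))⁻¹ * ∑ p : Fin N × Fin N,
        if p.1 < p.2 then
          (((N : ℝ) ^ β * V ((N : ℝ) ^ β * (x p.1 - x p.2)) : ℝ) : ℂ) * ψ x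
        else 0

/-- `H_N + c·Id`. -/
def HamPlus (ω β : ℝ) (V : ℝ → ℝ) (N : ℕ) (c : ℝ) (ψ : (Fin N → ℝ) → ℂ) :
    (Fin N → ℝ) → ℂ :=
  fun x => HamN ω β V N ψ x + (c : ℂ) * ψ x

/-- The product `S₁² S₂² ⋯ S_k²` (composition of the pairwise commuting operators `S_j²`
for the first `k` coordinates). -/
def Sprod (ω : ℝ) (N : ℕ) : ℕ → ((Fin N → ℝ) → ℂ) → ((Fin N → ℝ) → ℂ)
  | 0, ψ => ψ
  | (k+1), ψ => if h : k < N then Ssq ω ⟨k, h⟩ (Sprod ω N k ψ) else Sprod ω N k ψ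

/-- The real part of the `L²(ℝ^N)` inner product `⟨ψ, f⟩ = ∫ conj(ψ) f`. -/
def reInner {N : ℕ} (ψ f : (Fin N → ℝ) → ℂ) : ℝ :=
  (∫ x : Fin N → ℝ, (starRingEnd ℂ) (ψ x) * f x).re

/-- A function of `N` variables is symmetric if it is invariant under permutations of its
arguments. -/
def IsSymmetricFn {N : ℕ} (ψ : (Fin N → ℝ) → ℂ) : Prop :=
  ∀ (σ : Equiv.Perm (Fin N)) (x : Fin N → ℝ), ψ (x ∘ σ) = ψ x

/-- The product `∏_{i=1}^k (S²_{2i-1} + S²_{2i})` (composition of the pairwise commuting sum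
operators over consecutive pairs of coordinates). -/
def Pprod (ω : ℝ) (N : ℕ) : ℕ → ((Fin N → ℝ) → ℂ) → ((Fin N → ℝ) → ℂ)
  | 0, ψ => ψ
  | (k+1), ψ =>
    if h : 2*k + 1 < N then
      fun x => Ssq ω (⟨2*k, by omega⟩ : Fin N) (Pprod ω N k ψ) x
        + Ssq ω (⟨2*k + 1, h⟩ : Fin N) (Pprod ω N k ψ) x
    else Pprod ω N k ψ

open SchwartzMap LineDeriv

lemma deriv_comp_update {N : ℕ} (f : 𝓢(Fin N → ℝ, ℂ)) (j : Fin N) (x : Fin N → ℝ) :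
    deriv (fun t => f (Function.update x j t)) =
      fun t => (∂_{(Pi.single j 1 : Fin N → ℝ)} f) (Function.update x j t) := by
  funext t
  rw [lineDerivOp_apply_eq_fderiv]
  exact (f.differentiableAt.hasFDerivAt.comp_hasDerivAt t (hasDerivAt_update x j t)).deriv

lemma d2_schwartz {N : ℕ} (f : 𝓢(Fin N → ℝ, ℂ)) (j : Fin N) :
    d2 j f = ∂_{(Pi.single j 1 : Fin N → ℝ)} (∂_{(Pi.single j 1 : Fin N → ℝ)} f) := by
  funext x
  rw [d2, iteratedDeriv_succ', iteratedDeriv_one, deriv_comp_update, deriv_comp_update]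
  simp

/-- The operator `S_j²` as a continuous linear map on Schwartz space. -/
def schwartzSsq {N : ℕ} (ω : ℝ) (j : Fin N) : 𝓢(Fin N → ℝ, ℂ) →L[ℂ] 𝓢(Fin N → ℝ, ℂ) :=
  ContinuousLinearMap.id ℂ _
    - (1/2 : ℂ) • (lineDerivOpCLM ℂ 𝓢(Fin N → ℝ, ℂ) (Pi.single j 1 : Fin N → ℝ) ∘L
        lineDerivOpCLM ℂ 𝓢(Fin N → ℝ, ℂ) (Pi.single j 1 : Fin N → ℝ))
    + ((1/2 : ℂ) * (ω : ℂ) ^ 2) • smulLeftCLM ℂ (fun x : Fin N → ℝ => (x j : ℂ) * (x j : ℂ))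

lemma hasTemperateGrowth_eval_mul_self {N : ℕ} (j : Fin N) :
    (fun x : Fin N → ℝ => (x j : ℂ) * (x j : ℂ)).HasTemperateGrowth :=
  have h : (fun x : Fin N → ℝ => (x j : ℂ)).HasTemperateGrowth :=
    (ofRealCLM ∘L ContinuousLinearMap.proj (R := ℝ) (φ := fun _ : Fin N => ℝ) j).hasTemperateGrowth
  h.mul h

lemma coe_schwartzSsq {N : ℕ} (ω : ℝ) (j : Fin N) (f : 𝓢(Fin N → ℝ, ℂ)) :
    ⇑(schwartzSsq ω j f) = Ssq ω j f := by
  funext x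
  simp only [schwartzSsq, Ssq, d2_schwartz, add_apply, sub_apply, smul_apply,
    ContinuousLinearMap.comp_apply, ContinuousLinearMap.id_apply, lineDerivOpCLM_apply,
    smulLeftCLM_apply_apply (hasTemperateGrowth_eval_mul_self j), smul_eq_mul]
  ring

/-- The composition of the operators `S_j²` along a list of indices. -/
def schwartzSsqList {N : ℕ} (ω : ℝ) (l : List (Fin N)) :
    𝓢(Fin N → ℝ, ℂ) →L[ℂ] 𝓢(Fin N → ℝ, ℂ) :=
  (l.map (schwartzSsq ω)).prod

lemma schwartzSsqList_nil {N : ℕ} (ω : ℝ) (f : 𝓢(Fin N → ℝ, ℂ)) :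
    schwartzSsqList ω [] f = f := rfl

lemma schwartzSsqList_cons {N : ℕ} (ω : ℝ) (j : Fin N) (l : List (Fin N))
    (f : 𝓢(Fin N → ℝ, ℂ)) :
    schwartzSsqList ω (j :: l) f = schwartzSsq ω j (schwartzSsqList ω l f) := by
  simp [schwartzSsqList]

lemma schwartzSsqList_concat {N : ℕ} (ω : ℝ) (l : List (Fin N)) (j : Fin N)
    (f : 𝓢(Fin N → ℝ, ℂ)) :
    schwartzSsqList ω (l ++ [j]) f = schwartzSsqList ω l (schwartzSsq ω j f) := by
  simp [schwartzSsqList]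

lemma Ssq_comp_perm {N : ℕ} (ω : ℝ) (σ : Equiv.Perm (Fin N)) (j : Fin N)
    (f : (Fin N → ℝ) → ℂ) (x : Fin N → ℝ) :
    Ssq ω (σ j) (fun y => f (y ∘ σ)) x = Ssq ω j f (x ∘ σ) := by
  simp [Ssq, d2, Function.update_comp_equiv]

lemma schwartzSsqList_map_perm {N : ℕ} (ω : ℝ) (σ : Equiv.Perm (Fin N)) (l : List (Fin N))
    (f : 𝓢(Fin N → ℝ, ℂ)) (hsym : IsSymmetricFn f) (x : Fin N → ℝ) :
    schwartzSsqList ω (l.map σ) f x = schwartzSsqList ω l f (x ∘ σ) := by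
  induction l generalizing x with
  | nil => exact (hsym σ x).symm
  | cons j l ih =>
    rw [List.map_cons, schwartzSsqList_cons, schwartzSsqList_cons, coe_schwartzSsq,
      coe_schwartzSsq, ← Ssq_comp_perm, funext ih]

lemma integral_comp_perm {N : ℕ} (σ : Equiv.Perm (Fin N)) (g : (Fin N → ℝ) → ℂ) :
    ∫ x, g (x ∘ σ) = ∫ x, g x :=
  (volume_measurePreserving_piCongrLeft (fun _ : Fin N => ℝ) σ).symm.integral_comp' g

lemma List.Nodup.exists_perm_map_eq {α : Type*} {l l' : List α}
    (hl : l.Nodup) (hl' : l'.Nodup) (h : l.length = l'.length) :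
    ∃ σ : Equiv.Perm α, l.map σ = l' := by
  obtain ⟨σ, hσ⟩ := Equiv.Perm.exists_extending_pair l.get (fun i => l'.get (i.cast h))
    hl.injective_get (hl'.injective_get.comp (Fin.cast_injective h))
  refine ⟨σ, List.ext_get (by simpa using h) fun n h₁ h₂ => ?_⟩
  simpa using hσ ⟨n, h ▸ h₂⟩

lemma reInner_schwartzSsqList_eq {N : ℕ} (ω : ℝ) (ψ : 𝓢(Fin N → ℝ, ℂ))
    (hsym : IsSymmetricFn ψ) {l l' : List (Fin N)} (hl : l.Nodup) (hl' : l'.Nodup)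
    (h : l.length = l'.length) :
    reInner ψ (schwartzSsqList ω l ψ) = reInner ψ (schwartzSsqList ω l' ψ) := by
  obtain ⟨σ, rfl⟩ := hl.exists_perm_map_eq hl' h
  rw [reInner, reInner, ← integral_comp_perm σ]
  simp only [schwartzSsqList_map_perm ω σ l ψ hsym, hsym σ]

lemma reInner_add {N : ℕ} (ψ f g : 𝓢(Fin N → ℝ, ℂ)) :
    reInner ψ (f + g : 𝓢(Fin N → ℝ, ℂ)) = reInner ψ f + reInner ψ g := by
  have h (u : 𝓢(Fin N → ℝ, ℂ)) : Integrable (fun x => (starRingEnd ℂ) (ψ x) * u x) := by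
    have hψ : MemLp (fun x => (starRingEnd ℂ) (ψ x)) 2 := (ψ.memLp 2 volume).star
    exact hψ.integrable_mul (u.memLp 2 volume)
  simp only [reInner, add_apply, mul_add]
  rw [integral_add (h f) (h g), add_re]

lemma exists_schwartz_Sprod {N : ℕ} (ω : ℝ) (k : ℕ) (hk : k ≤ N) (ψ : 𝓢(Fin N → ℝ, ℂ)) :
    ∃ l : List (Fin N), l.Nodup ∧ l.length = k ∧ (∀ j ∈ l, (j : ℕ) < k) ∧
      Sprod ω N k ψ = schwartzSsqList ω l ψ := by
  induction k with
  | zero => exact ⟨[], by simp, rfl, by simp, rfl⟩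
  | succ k ih =>
    obtain ⟨l, hl, hlen, hlt, heq⟩ := ih (by omega)
    refine ⟨⟨k, hk⟩ :: l, List.nodup_cons.2 ⟨fun h => (hlt _ h).false, hl⟩, by simp [hlen],
      ?_, ?_⟩
    · intro j hj
      rcases List.mem_cons.1 hj with rfl | hj
      · exact k.lt_succ_self
      · exact (hlt j hj).trans k.lt_succ_self
    · rw [Sprod, dif_pos (show k < N from hk), heq, schwartzSsqList_cons, coe_schwartzSsq]

lemma exists_schwartz_Pprod {N : ℕ} (ω : ℝ) (k : ℕ) (hk : 2 * k ≤ N) (ψ : 𝓢(Fin N → ℝ, ℂ))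
    (hsym : IsSymmetricFn ψ) :
    ∃ F : 𝓢(Fin N → ℝ, ℂ), Pprod ω N k ψ = F ∧
      ∀ l l' : List (Fin N), l.Nodup → l'.Nodup → l'.length = l.length + k →
        (∀ j ∈ l, 2 * k ≤ (j : ℕ)) →
        reInner ψ (schwartzSsqList ω l F) = 2 ^ k * reInner ψ (schwartzSsqList ω l' ψ) := by
  induction k with
  | zero =>
    refine ⟨ψ, rfl, fun l l' hl hl' hlen _ => ?_⟩
    rw [pow_zero, one_mul, reInner_schwartzSsqList_eq ω ψ hsym hl hl' hlen.symm]
  | succ k ih =>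
    obtain ⟨F, hF, hred⟩ := ih (by omega)
    have hlt : 2 * k + 1 < N := by omega
    refine ⟨schwartzSsq ω ⟨2 * k, by omega⟩ F + schwartzSsq ω ⟨2 * k + 1, hlt⟩ F, ?_, ?_⟩
    · funext x
      rw [Pprod, dif_pos hlt, hF, add_apply, coe_schwartzSsq, coe_schwartzSsq]
    · intro l l' hl hl' hlen hge
      have key (i : Fin N) (h₁ : 2 * k ≤ (i : ℕ)) (h₂ : (i : ℕ) < 2 * (k + 1)) :
          reInner ψ (schwartzSsqList ω l (schwartzSsq ω i F)) =
            2 ^ k * reInner ψ (schwartzSsqList ω l' ψ) := by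
        rw [← schwartzSsqList_concat]
        refine hred _ l' ?_ hl' (by simp; omega) ?_
        · refine List.nodup_append.2 ⟨hl, List.nodup_singleton i, ?_⟩
          intro a ha b hb hab
          have := hge a ha
          rw [hab, List.mem_singleton.1 hb] at this
          omega
        · intro j hj
          rcases List.mem_append.1 hj with hj | hj
          · have := hge j hj
            omega
          · rwa [List.mem_singleton.1 hj]
      rw [map_add, reInner_add, key _ le_rfl (by dsimp only; omega),
        key _ (Nat.le_succ _) (by dsimp only; omega)]
      ring

/-- **Symmetrization identity** (identity (4.12)): for `N ≥ 2k` and symmetric Schwartz `ψ`,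
`Re ⟨ψ, ∏_{i=1}^k (S²_{2i-1} + S²_{2i}) ψ⟩ = 2^k Re ⟨ψ, S₁² ⋯ S_k² ψ⟩`. -/
theorem symmetrization_identity (ω : ℝ) (k N : ℕ) (hk : 1 ≤ k) (hN : 2*k ≤ N)
    (ψ : SchwartzMap (Fin N → ℝ) ℂ) (hsym : IsSymmetricFn ⇑ψ) :
    reInner ⇑ψ (Pprod ω N k ⇑ψ) = 2 ^ k * reInner ⇑ψ (Sprod ω N k ⇑ψ) := by
  obtain ⟨l', hl', hlen, -, hS⟩ := exists_schwartz_Sprod ω k (by omega) ψ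
  obtain ⟨F, hF, hred⟩ := exists_schwartz_Pprod ω k hN ψ hsym
  rw [hF, hS, ← hred [] l' List.nodup_nil hl' (by simpa using hlen) (by simp),
    schwartzSsqList_nil]

end
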